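/- For every α ∈ (0,1/2) and every f ∈ 𝒲₁, the function x ↦ 𝔗_α(f)(√x) is concave on [0,∞). -/

import Mathlib

open Real MeasureTheory Set Filter BoundedContinuousFunction

noncomputable section

namespace GSQGhalfplane

/-- The constant `c_{0,α} = 2^{2α-1} Γ(1+α) / (π Γ(1-α))`. -/
def C0 (α : ℝ) : ℝ := (2:ℝ) ^ (2*α - 1) * Real.Gamma (1 + α) / (π * Real.Gamma (1 - α))

/-- The constant `c'''_{0,α}`. -/
def C3 (α : ℝ) : ℝ :=
  ((4:ℝ) ^ (1 + α) - 4 + α - 4*α^3) * Real.Gamma α /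
    (2*π*α*(5 - 2*α)*(3 - 2*α)*(1 - 2*α)*Real.Gamma (2 - α))

/-- The exponent `δ_u = c'''_{0,α} t₀^{1/2-α} / (1 + c'''_{0,α} t₀^{1/2-α})`. -/
def deltaU (α t0 : ℝ) : ℝ :=
  C3 α * t0 ^ (1/2 - α) / (1 + C3 α * t0 ^ (1/2 - α))

/-- The lower barrier `f_l(x) = (1 + t₀^{-2} x²)^{-δ_l}`. -/
def fl (t0 δl x : ℝ) : ℝ := (1 + x^2 / t0^2) ^ (-δl)

/-- The upper barrier `f_u(x) = min(1, t₀^{δ_u} |x|^{-δ_u})` (with value `1` at `x = 0`). -/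
def fu (α t0 x : ℝ) : ℝ :=
  if x = 0 then 1 else min 1 (t0 ^ deltaU α t0 * |x| ^ (-(deltaU α t0)))

/-- The invariant set `𝒲₁`: even continuous bounded functions with `f(0)=1`,
nonnegative and non-increasing on `[0,∞)`, `x ↦ f(√x)` convex,
`f_l ≤ f ≤ f_u`, and left derivative at `t₀` at most `-t₀^{α-3/2}`. -/
def W1 (α t0 δl : ℝ) (f : ℝ → ℝ) : Prop :=
  Continuous f ∧ (∃ M : ℝ, ∀ x : ℝ, |f x| ≤ M) ∧ (∀ x : ℝ, f (-x) = f x) ∧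
  f 0 = 1 ∧ (∀ x ∈ Ici (0:ℝ), 0 ≤ f x) ∧ AntitoneOn f (Ici (0:ℝ)) ∧
  ConvexOn ℝ (Ici (0:ℝ)) (fun x => f (Real.sqrt x)) ∧
  (∀ x : ℝ, fl t0 δl x ≤ f x) ∧ (∀ x : ℝ, f x ≤ fu α t0 x) ∧
  (∃ d : ℝ, HasDerivWithinAt f d (Iio t0) t0 ∧ d ≤ -(t0 ^ (α - 3/2)))

/-- The linear operator `𝔗_α(f)`, defined for `x > 0`, set to `0` at `x = 0`,
and extended evenly to `ℝ` (via `|x|`). -/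
def Tfr (α : ℝ) (f : ℝ → ℝ) (x : ℝ) : ℝ :=
  if x = 0 then 0
  else (C0 α / α) * ∫ ξ in Ioi (0:ℝ),
    f ξ * (4*α * ξ ^ (-(2*α)) - (ξ / |x|) * (|(|x| - ξ)| ^ (-(2*α)) - (|x| + ξ) ^ (-(2*α))))

/-- The nonlinear map `ℜ_α(f)(x) = exp(-∫₀^{|x|} 𝔗_α(f)(y)/(y(1+𝔗_α(f)(y))) dy)`. -/
def Rfr (α : ℝ) (f : ℝ → ℝ) (x : ℝ) : ℝ :=
  Real.exp (-(∫ y in (0:ℝ)..|x|, Tfr α f y / (y * (1 + Tfr α f y))))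

/-- The functional `𝔟(f) = 4 c_{0,α} ∫₀^∞ f(ξ) ξ^{-2α} dξ`. -/
def bfr (α : ℝ) (f : ℝ → ℝ) : ℝ := 4 * C0 α * ∫ ξ in Ioi (0:ℝ), f ξ * ξ ^ (-(2*α))

/-- The functional `𝔠(f) = (8(1+2α)(1+α)/3) c_{0,α} ∫₀^∞ (1-f(ξ)) ξ^{-2-2α} dξ`. -/
def cfr (α : ℝ) (f : ℝ → ℝ) : ℝ :=
  (8*(1+2*α)*(1+α)/3) * C0 α * ∫ ξ in Ioi (0:ℝ), (1 - f ξ) * ξ ^ (-2 - 2*α)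

/-- The lower bound `b'_α`. -/
def bLow (α t0 δl : ℝ) : ℝ :=
  2 * C0 α * t0 ^ (1 - 2*α) * Real.Gamma (1/2 - α) * Real.Gamma (α + δl - 1/2) /
    Real.Gamma δl

/-- The upper bound `b''_α`. -/
def bHigh (α t0 : ℝ) : ℝ :=
  4 * C0 α * t0 ^ (1 - 2*α) * (1/(1 - 2*α) + 1/(deltaU α t0 + 2*α - 1))

/-- The upper bound `c''_{0,α}`. -/
def cHigh (α t0 δl : ℝ) : ℝ :=
  C0 α * t0 ^ (-1 - 2*α) * 8 * (1 + α) * Real.Gamma (1/2 - α) *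
    Real.Gamma (δl + α + 1/2) / (3 * Real.Gamma δl)

lemma lintegral_Ioi_sq_sub_sq_rpow (a : ℝ) {b : ℝ} (hb : 0 < b) :
    ∫⁻ p in Ioi b, ENNReal.ofReal ((p ^ 2 - b ^ 2) ^ (-((1 + a) / 2))) =
      ENNReal.ofReal (b ^ (-a)) *
        ∫⁻ p in Ioi (1 : ℝ), ENNReal.ofReal ((p ^ 2 - 1) ^ (-((1 + a) / 2))) := by
  have himg : (fun p : ℝ => b * p) '' Ioi 1 = Ioi b := by
    rw [Set.image_mul_left_Ioi hb, mul_one]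
  rw [← himg, lintegral_image_eq_lintegral_abs_deriv_mul measurableSet_Ioi
    (f' := fun _ => b) (fun p _ => by simpa using ((hasDerivAt_id p).const_mul b).hasDerivWithinAt)
    (mul_right_injective₀ hb.ne').injOn, ← lintegral_const_mul' _ _ ENNReal.ofReal_ne_top]
  refine setLIntegral_congr_fun measurableSet_Ioi fun p hp => ?_
  have hp : 1 < p := hp
  have h1 : (b * p) ^ 2 - b ^ 2 = b ^ 2 * (p ^ 2 - 1) := by ring
  have h2 : b * (b ^ 2) ^ (-((1 + a) / 2)) = b ^ (-a) := by
    rw [← Real.rpow_natCast b 2, ← Real.rpow_mul hb.le]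
    nth_rewrite 1 [← Real.rpow_one b]
    rw [← Real.rpow_add hb]
    congr 1
    push_cast
    ring
  rw [← ENNReal.ofReal_mul (abs_nonneg _), ← ENNReal.ofReal_mul (by positivity), abs_of_pos hb, h1,
    mul_rpow (by positivity) (by nlinarith), ← mul_assoc, h2]

lemma image_div_sub_Ioo {x ξ : ℝ} (hx : 0 < x) (hξ : 0 < ξ) :
    (fun σ : ℝ => x * ξ / σ - σ) '' Ioo 0 (min x ξ) = Ioi |x - ξ| := by
  ext p
  simp only [mem_image, mem_Ioo, lt_min_iff, mem_Ioi]
  constructor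
  · rintro ⟨σ, ⟨h0, h1, h2⟩, rfl⟩
    rw [lt_sub_iff_add_lt, lt_div_iff₀ h0]
    rcases abs_cases (x - ξ) with h | h <;> rw [h.1] <;> nlinarith
  · intro hp
    have hxξ := mul_pos hx hξ
    have hp0 : 0 < p := (abs_nonneg _).trans_lt hp
    rw [abs_lt] at hp
    have hs : √(p ^ 2 + 4 * (x * ξ)) ^ 2 = p ^ 2 + 4 * (x * ξ) := sq_sqrt (by positivity)
    have hlt : p < √(p ^ 2 + 4 * (x * ξ)) := Real.lt_sqrt_of_sq_lt (by linarith)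
    have hx' : √(p ^ 2 + 4 * (x * ξ)) < 2 * x + p := by
      rw [Real.sqrt_lt' (by positivity)]
      nlinarith
    have hξ' : √(p ^ 2 + 4 * (x * ξ)) < 2 * ξ + p := by
      rw [Real.sqrt_lt' (by positivity)]
      nlinarith
    refine ⟨(√(p ^ 2 + 4 * (x * ξ)) - p) / 2, ⟨by linarith, by linarith, by linarith⟩, ?_⟩
    generalize √(p ^ 2 + 4 * (x * ξ)) = r at *
    have : r - p ≠ 0 := (sub_pos.2 hlt).ne'
    field_simp
    nlinarith

lemma image_div_add_Ioo {x ξ : ℝ} (hx : 0 < x) (hξ : 0 < ξ) :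
    (fun σ : ℝ => x * ξ / σ + σ) '' Ioo 0 (min x ξ) = Ioi (x + ξ) := by
  ext p
  simp only [mem_image, mem_Ioo, lt_min_iff, mem_Ioi]
  constructor
  · rintro ⟨σ, ⟨h0, h1, h2⟩, rfl⟩
    rw [← sub_lt_iff_lt_add, lt_div_iff₀ h0]
    nlinarith [mul_pos (sub_pos.2 h1) (sub_pos.2 h2)]
  · intro hp
    have hxξ := mul_pos hx hξ
    have hp0 : 0 < p := by linarith
    have hs : √(p ^ 2 - 4 * (x * ξ)) ^ 2 = p ^ 2 - 4 * (x * ξ) :=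
      sq_sqrt (by nlinarith [sq_nonneg (x - ξ)])
    have hlt : √(p ^ 2 - 4 * (x * ξ)) < p := by
      rw [Real.sqrt_lt' hp0]
      linarith
    have hx' : p - 2 * x < √(p ^ 2 - 4 * (x * ξ)) := Real.lt_sqrt_of_sq_lt (by nlinarith)
    have hξ' : p - 2 * ξ < √(p ^ 2 - 4 * (x * ξ)) := Real.lt_sqrt_of_sq_lt (by nlinarith)
    refine ⟨(p - √(p ^ 2 - 4 * (x * ξ))) / 2, ⟨by linarith, by linarith, by linarith⟩, ?_⟩
    generalize √(p ^ 2 - 4 * (x * ξ)) = r at *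
    have : p - r ≠ 0 := (sub_pos.2 hlt).ne'
    field_simp
    nlinarith

/-- The odd kernel `|x - ξ|^{-a} - (x + ξ)^{-a}` as a superposition of products of one-variable
kernels. -/
lemma lintegral_kernel {a x ξ : ℝ} (hx : 0 < x) (hξ : 0 < ξ) (hne : x ≠ ξ) :
    (∫⁻ σ in Ioo 0 (min x ξ), ENNReal.ofReal
        (2 * ((x ^ 2 - σ ^ 2) * (ξ ^ 2 - σ ^ 2) / σ ^ 2) ^ (-((1 + a) / 2)))) +
      ENNReal.ofReal ((x + ξ) ^ (-a)) *
        ∫⁻ p in Ioi (1 : ℝ), ENNReal.ofReal ((p ^ 2 - 1) ^ (-((1 + a) / 2))) =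
    ENNReal.ofReal (|x - ξ| ^ (-a)) *
        ∫⁻ p in Ioi (1 : ℝ), ENNReal.ofReal ((p ^ 2 - 1) ^ (-((1 + a) / 2))) := by
  have hxξ := mul_pos hx hξ
  have hdiv : ∀ σ ∈ Ioo 0 (min x ξ), HasDerivAt (fun σ : ℝ => x * ξ / σ) (-(x * ξ) / σ ^ 2) σ := by
    intro σ hσ
    have h := (hasDerivAt_const σ (x * ξ)).fun_div (hasDerivAt_id' σ) hσ.1.ne'
    simpa using h
  have hbig : ∀ σ ∈ Ioo 0 (min x ξ), 1 < x * ξ / σ ^ 2 := by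
    rintro σ ⟨h0, h1⟩
    obtain ⟨h1, h2⟩ := lt_min_iff.1 h1
    rw [one_lt_div (by positivity)]
    nlinarith
  have inj_sub : InjOn (fun σ : ℝ => x * ξ / σ - σ) (Ioo 0 (min x ξ)) := by
    refine StrictAntiOn.injOn fun s hs t ht hst => ?_
    have := div_lt_div_of_pos_left hxξ hs.1 hst
    linarith
  have inj_add : InjOn (fun σ : ℝ => x * ξ / σ + σ) (Ioo 0 (min x ξ)) := by
    refine StrictAntiOn.injOn fun s hs t ht hst => ?_
    have h1 := lt_min_iff.1 hs.2
    have h2 := lt_min_iff.1 ht.2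
    have hs0 := hs.1
    have ht0 := ht.1
    have h3 : x * ξ / s - x * ξ / t = (t - s) * (x * ξ / (s * t)) := by
      field_simp
    have h4 : 1 < x * ξ / (s * t) := by
      rw [one_lt_div (by positivity)]
      exact mul_lt_mul'' h1.1 h2.2 hs0.le ht0.le
    nlinarith
  rw [← lintegral_Ioi_sq_sub_sq_rpow a (abs_pos.2 (sub_ne_zero.2 hne)),
    ← lintegral_Ioi_sq_sub_sq_rpow a (add_pos hx hξ), ← image_div_sub_Ioo hx hξ,
    ← image_div_add_Ioo hx hξ,
    lintegral_image_eq_lintegral_abs_deriv_mul measurableSet_Ioo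
      (fun σ hσ => ((hdiv σ hσ).fun_sub (hasDerivAt_id' σ)).hasDerivWithinAt) inj_sub,
    lintegral_image_eq_lintegral_abs_deriv_mul measurableSet_Ioo
      (fun σ hσ => ((hdiv σ hσ).fun_add (hasDerivAt_id' σ)).hasDerivWithinAt) inj_add,
    ← lintegral_add_left (by fun_prop)]
  refine setLIntegral_congr_fun measurableSet_Ioo fun σ hσ => ?_
  have hb := hbig σ hσ
  obtain ⟨h0, h1⟩ := hσ
  obtain ⟨h1, h2⟩ := lt_min_iff.1 h1
  have e1 : (x * ξ / σ - σ) ^ 2 - |x - ξ| ^ 2 = (x ^ 2 - σ ^ 2) * (ξ ^ 2 - σ ^ 2) / σ ^ 2 := by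
    rw [sq_abs]
    field_simp
    ring
  have e2 : (x * ξ / σ + σ) ^ 2 - (x + ξ) ^ 2 = (x ^ 2 - σ ^ 2) * (ξ ^ 2 - σ ^ 2) / σ ^ 2 := by
    field_simp
    ring
  have hw : 0 ≤ (x ^ 2 - σ ^ 2) * (ξ ^ 2 - σ ^ 2) / σ ^ 2 :=
    div_nonneg (mul_nonneg (by nlinarith) (by nlinarith)) (sq_nonneg _)
  simp only [e1, e2]
  rw [← ENNReal.ofReal_mul (abs_nonneg _), ← ENNReal.ofReal_mul (abs_nonneg _),
    ← ENNReal.ofReal_add (by positivity) (by positivity), ← add_mul]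
  congr 2
  rw [neg_div, abs_of_neg (by linarith), abs_of_neg (by linarith)]
  ring

lemma lintegral_Ioi_comp_sqrt {σ : ℝ} (hσ : 0 < σ) (G : ℝ → ENNReal) :
    ∫⁻ ξ in Ioi σ, G ξ =
      ∫⁻ η in Ioi (0 : ℝ), ENNReal.ofReal (η / √(σ ^ 2 + η ^ 2)) * G √(σ ^ 2 + η ^ 2) := by
  have himg : (fun η : ℝ => √(σ ^ 2 + η ^ 2)) '' Ioi 0 = Ioi σ := by
    ext ξ
    simp only [mem_image, mem_Ioi]
    constructor
    · rintro ⟨η, h, rfl⟩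
      exact Real.lt_sqrt_of_sq_lt (by nlinarith)
    · intro h
      have : 0 < ξ ^ 2 - σ ^ 2 := by nlinarith
      refine ⟨√(ξ ^ 2 - σ ^ 2), Real.sqrt_pos.2 this, ?_⟩
      rw [sq_sqrt this.le, add_sub_cancel, sqrt_sq (by linarith)]
  have hinj : InjOn (fun η : ℝ => √(σ ^ 2 + η ^ 2)) (Ioi 0) := by
    refine StrictMonoOn.injOn fun s hs t ht hst => Real.sqrt_lt_sqrt (by positivity) ?_
    have hs : 0 < s := hs
    nlinarith
  have hder : ∀ η ∈ Ioi (0 : ℝ), HasDerivWithinAt (fun η : ℝ => √(σ ^ 2 + η ^ 2))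
      (η / √(σ ^ 2 + η ^ 2)) (Ioi 0) η := by
    intro η hη
    have h := (((hasDerivAt_pow 2 η).const_add (σ ^ 2)).sqrt (by positivity)).hasDerivWithinAt
      (s := Ioi 0)
    rwa [Nat.add_one_sub_one, pow_one, Nat.cast_ofNat, mul_div_mul_left _ _ two_ne_zero] at h
  rw [← himg, lintegral_image_eq_lintegral_abs_deriv_mul measurableSet_Ioi hder hinj]
  refine setLIntegral_congr_fun measurableSet_Ioi fun η hη => ?_
  have hη : 0 < η := hη
  rw [abs_of_nonneg (by positivity)]

lemma lintegral_Ioo_zero_eq_mul {x : ℝ} (hx : 0 < x) (H : ℝ → ENNReal) :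
    ∫⁻ σ in Ioo 0 x, H σ = ∫⁻ τ in Ioo (0 : ℝ) 1, ENNReal.ofReal x * H (x * τ) := by
  have himg : (fun p : ℝ => x * p) '' Ioo 0 1 = Ioo 0 x := by
    rw [Set.image_mul_left_Ioo hx, mul_one, mul_zero]
  rw [← himg, lintegral_image_eq_lintegral_abs_deriv_mul measurableSet_Ioo
    (f' := fun _ => x) (fun p _ => by simpa using ((hasDerivAt_id p).const_mul x).hasDerivWithinAt)
    (mul_right_injective₀ hx.ne').injOn, abs_of_pos hx]

lemma lintegral_Ioi_Ioo_min_swap {x : ℝ} {G : ℝ → ℝ → ENNReal}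
    (hG : Measurable (Function.uncurry G)) :
    ∫⁻ ξ in Ioi (0 : ℝ), ∫⁻ σ in Ioo 0 (min x ξ), G ξ σ =
      ∫⁻ σ in Ioo 0 x, ∫⁻ ξ in Ioi σ, G ξ σ := by
  have hS : MeasurableSet {z : ℝ × ℝ | 0 < z.2 ∧ z.2 < x ∧ z.2 < z.1} := by
    refine (measurableSet_lt measurable_const measurable_snd).inter
      ((measurableSet_lt measurable_snd measurable_const).inter
        (measurableSet_lt measurable_snd measurable_fst))
  have key := lintegral_lintegral_swap (μ := (volume : Measure ℝ)) (ν := (volume : Measure ℝ))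
    (f := fun ξ σ => {z : ℝ × ℝ | 0 < z.2 ∧ z.2 < x ∧ z.2 < z.1}.indicator
      (Function.uncurry G) (ξ, σ)) (hG.indicator hS).aemeasurable
  convert key using 1
  · rw [← lintegral_indicator measurableSet_Ioi]
    refine lintegral_congr fun ξ => ?_
    rw [Set.indicator_apply, ← lintegral_indicator measurableSet_Ioo]
    split_ifs with h
    · refine lintegral_congr fun σ => ?_
      simp [Set.indicator_apply]
    · rw [← lintegral_zero (μ := (volume : Measure ℝ))]
      refine lintegral_congr fun σ => (indicator_of_notMem ?_ _).symm
      exact fun hσ => h (hσ.1.trans hσ.2.2)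
  · rw [← lintegral_indicator measurableSet_Ioo]
    refine lintegral_congr fun σ => ?_
    rw [Set.indicator_apply, ← lintegral_indicator measurableSet_Ioi]
    split_ifs with h
    · refine lintegral_congr fun ξ => ?_
      simp [Set.indicator_apply, h.1, h.2]
    · rw [← lintegral_zero (μ := (volume : Measure ℝ))]
      refine lintegral_congr fun ξ => (indicator_of_notMem ?_ _).symm
      exact fun hσ => h ⟨hσ.1, hσ.2.1⟩

lemma integrableOn_Ioi_sq_sub_one_rpow {a : ℝ} (ha0 : 0 < a) (ha1 : a < 1) :
    IntegrableOn (fun p : ℝ => (p ^ 2 - 1) ^ (-((1 + a) / 2))) (Ioi 1) := by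
  have hmeas : Measurable fun p : ℝ => (p ^ 2 - 1) ^ (-((1 + a) / 2)) := by fun_prop
  rw [← Ioc_union_Ioi_eq_Ioi (show (1 : ℝ) ≤ 2 by norm_num)]
  refine IntegrableOn.union ?_ ?_
  · have h0 : IntervalIntegrable (fun p : ℝ => p ^ (-((1 + a) / 2))) volume 0 1 :=
      intervalIntegral.intervalIntegrable_rpow' (by linarith)
    have h1 := h0.comp_sub_right 1
    rw [intervalIntegrable_iff_integrableOn_Ioc_of_le (by norm_num)] at h1
    norm_num at h1
    refine Integrable.mono' h1 hmeas.aestronglyMeasurable ?_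
    filter_upwards [ae_restrict_mem measurableSet_Ioc] with p hp
    have hp1 := hp.1
    rw [Real.norm_of_nonneg (rpow_nonneg (by nlinarith) _)]
    exact rpow_le_rpow_of_nonpos (by linarith) (by nlinarith) (by linarith)
  · have h1 : IntegrableOn (fun p : ℝ => (1 / 4 : ℝ) ^ (-((1 + a) / 2)) * p ^ (-(1 + a))) (Ioi 2) :=
      (integrableOn_Ioi_rpow_of_lt (by linarith) (by norm_num)).const_mul _
    refine Integrable.mono' h1 hmeas.aestronglyMeasurable ?_
    filter_upwards [ae_restrict_mem measurableSet_Ioi] with p hp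
    have hp : 2 < p := hp
    have h2 : p ^ (-(1 + a)) = (p ^ 2) ^ (-((1 + a) / 2)) := by
      rw [← Real.rpow_natCast p 2, ← Real.rpow_mul (by linarith)]
      congr 1
      push_cast
      ring
    rw [Real.norm_of_nonneg (rpow_nonneg (by nlinarith) _), h2,
      ← mul_rpow (by norm_num) (by positivity)]
    exact rpow_le_rpow_of_nonpos (by positivity) (by nlinarith) (by linarith)

lemma integral_Ioi_inv_sq_mul_sq_sub_one_rpow {a : ℝ} (ha0 : 0 < a) (ha1 : a < 1) :
    IntegrableOn (fun p : ℝ => (p ^ 2)⁻¹ * (p ^ 2 - 1) ^ (-((1 + a) / 2))) (Ioi 1) ∧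
    ∫ p in Ioi (1 : ℝ), (p ^ 2)⁻¹ * (p ^ 2 - 1) ^ (-((1 + a) / 2)) =
      a * ∫ p in Ioi (1 : ℝ), (p ^ 2 - 1) ^ (-((1 + a) / 2)) := by
  have hJ := integrableOn_Ioi_sq_sub_one_rpow ha0 ha1
  have hM : IntegrableOn (fun p : ℝ => (p ^ 2)⁻¹ * (p ^ 2 - 1) ^ (-((1 + a) / 2))) (Ioi 1) := by
    refine Integrable.mono' hJ (by fun_prop) ?_
    filter_upwards [ae_restrict_mem measurableSet_Ioi] with p hp
    have hp : 1 < p := hp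
    have h0 : 0 ≤ (p ^ 2 - 1) ^ (-((1 + a) / 2)) := rpow_nonneg (by nlinarith) _
    rw [Real.norm_of_nonneg (by positivity)]
    exact mul_le_of_le_one_left h0 (inv_le_one_of_one_le₀ (by nlinarith))
  refine ⟨hM, ?_⟩
  have hder : ∀ p ∈ Ioi (1 : ℝ), HasDerivAt (fun p : ℝ => (p ^ 2 - 1) ^ ((1 - a) / 2) / p)
      ((p ^ 2)⁻¹ * (p ^ 2 - 1) ^ (-((1 + a) / 2)) - a * (p ^ 2 - 1) ^ (-((1 + a) / 2))) p := by
    intro p hp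
    have hp : 1 < p := hp
    have hp2 : 0 < p ^ 2 - 1 := by nlinarith
    have h := ((((hasDerivAt_pow 2 p).sub_const 1).rpow_const (p := (1 - a) / 2)
      (Or.inl hp2.ne')).fun_div (hasDerivAt_id' p) (by positivity))
    refine h.congr_deriv ?_
    have e1 : (1 - a) / 2 - 1 = -((1 + a) / 2) := by ring
    have e2 : (p ^ 2 - 1) ^ ((1 - a) / 2) = (p ^ 2 - 1) * (p ^ 2 - 1) ^ (-((1 + a) / 2)) := by
      nth_rewrite 2 [← Real.rpow_one (p ^ 2 - 1)]
      rw [← Real.rpow_add hp2]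
      congr 1
      ring
    rw [e1, e2]
    have : p ≠ 0 := by positivity
    field_simp
    ring
  have hcont : ContinuousWithinAt (fun p : ℝ => (p ^ 2 - 1) ^ ((1 - a) / 2) / p) (Ici 1) 1 := by
    refine ContinuousAt.continuousWithinAt (ContinuousAt.div ?_ continuousAt_id one_ne_zero)
    exact ContinuousAt.rpow_const (by fun_prop) (Or.inr (by linarith))
  have hlim : Tendsto (fun p : ℝ => (p ^ 2 - 1) ^ ((1 - a) / 2) / p) atTop (nhds 0) := by
    refine squeeze_zero' ?_ ?_ (tendsto_rpow_neg_atTop ha0)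
    · filter_upwards [eventually_gt_atTop 1] with p hp
      exact div_nonneg (rpow_nonneg (by nlinarith) _) (by linarith)
    · filter_upwards [eventually_gt_atTop 1] with p hp
      have hp0 : 0 < p := by linarith
      rw [div_le_iff₀ hp0]
      calc (p ^ 2 - 1) ^ ((1 - a) / 2) ≤ (p ^ 2) ^ ((1 - a) / 2) :=
            rpow_le_rpow (by nlinarith) (by linarith) (by linarith)
        _ = p ^ (-a) * p := by
            nth_rewrite 3 [← Real.rpow_one p]
            rw [← Real.rpow_natCast p 2, ← Real.rpow_mul hp0.le, ← Real.rpow_add hp0]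
            congr 1
            push_cast
            ring
  have h := integral_Ioi_of_hasDerivAt_of_tendsto hcont hder (hM.sub (hJ.const_mul a)) hlim
  rw [integral_sub hM (hJ.const_mul a), integral_const_mul] at h
  have h0 : ((1 : ℝ) ^ 2 - 1) ^ ((1 - a) / 2) = 0 := by
    rw [one_pow, sub_self, Real.zero_rpow (by linarith)]
  rw [h0] at h
  linarith

lemma lintegral_Ioi_sq_sub_one_rpow_ne_top {a : ℝ} (ha0 : 0 < a) (ha1 : a < 1) :
    ∫⁻ p in Ioi (1 : ℝ), ENNReal.ofReal ((p ^ 2 - 1) ^ (-((1 + a) / 2))) ≠ ⊤ :=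
  (integrableOn_Ioi_sq_sub_one_rpow ha0 ha1).lintegral_lt_top.ne

lemma lintegral_Ioi_sq_sub_one_rpow_ne_zero (a : ℝ) :
    ∫⁻ p in Ioi (1 : ℝ), ENNReal.ofReal ((p ^ 2 - 1) ^ (-((1 + a) / 2))) ≠ 0 := by
  refine ((setLIntegral_pos_iff (by fun_prop)).2 ?_).ne'
  have h : Ioi (1 : ℝ) ⊆
      Function.support (fun p : ℝ => ENNReal.ofReal ((p ^ 2 - 1) ^ (-((1 + a) / 2)))) := by
    intro p hp
    have hp : 1 < p := hp
    have : 0 < (p ^ 2 - 1) ^ (-((1 + a) / 2)) := rpow_pos_of_pos (by nlinarith) _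
    simpa using this
  rw [inter_eq_self_of_subset_right h]
  simp

lemma lintegral_Ioo_inv_sq_sub_one_rpow {a : ℝ} (ha0 : 0 < a) (ha1 : a < 1) :
    ∫⁻ τ in Ioo (0 : ℝ) 1, ENNReal.ofReal (((τ ^ 2)⁻¹ - 1) ^ (-((1 + a) / 2))) =
      ENNReal.ofReal a *
        ∫⁻ p in Ioi (1 : ℝ), ENNReal.ofReal ((p ^ 2 - 1) ^ (-((1 + a) / 2))) := by
  have himg : (fun p : ℝ => p⁻¹) '' Ioi 1 = Ioo 0 1 := by
    rw [Set.image_inv_eq_inv, Set.inv_Ioi₀ one_pos, inv_one]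
  obtain ⟨hM, hMJ⟩ := integral_Ioi_inv_sq_mul_sq_sub_one_rpow ha0 ha1
  have hJ := integrableOn_Ioi_sq_sub_one_rpow ha0 ha1
  have hJ0 : 0 ≤ᵐ[volume.restrict (Ioi 1)] fun p : ℝ => (p ^ 2 - 1) ^ (-((1 + a) / 2)) := by
    filter_upwards [ae_restrict_mem measurableSet_Ioi] with p hp
    have hp : 1 < p := hp
    exact rpow_nonneg (by nlinarith) _
  have hM0 : 0 ≤ᵐ[volume.restrict (Ioi 1)]
      fun p : ℝ => (p ^ 2)⁻¹ * (p ^ 2 - 1) ^ (-((1 + a) / 2)) := by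
    filter_upwards [hJ0] with p hp using mul_nonneg (by positivity) hp
  rw [← ofReal_integral_eq_lintegral_ofReal hJ hJ0, ← ENNReal.ofReal_mul ha0.le, ← hMJ,
    ofReal_integral_eq_lintegral_ofReal hM hM0, ← himg,
    lintegral_image_eq_lintegral_abs_deriv_mul measurableSet_Ioi (f' := fun p => -(p ^ 2)⁻¹)
      (fun p hp => (hasDerivAt_inv (zero_lt_one.trans hp).ne').hasDerivWithinAt)
      inv_injective.injOn]
  refine setLIntegral_congr_fun measurableSet_Ioi fun p hp => ?_
  rw [abs_neg, abs_of_nonneg (by positivity), ENNReal.ofReal_mul (by positivity), inv_pow, inv_inv]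

/-- The potential of a radial profile in the squared variable: up to normalisation,
`y ↦ x⁻¹ ∫ ξ f(ξ) (|x - ξ|^{-a} - (x + ξ)^{-a}) dξ` with `x = √y`, written as a superposition of
the functions `y ↦ f(√(y τ² + η²))`. -/
def radialPotential (a : ℝ) (f : ℝ → ℝ) (y : ℝ) : ENNReal :=
  ∫⁻ τ in Ioo (0 : ℝ) 1, ENNReal.ofReal (2 * ((τ ^ 2)⁻¹ - 1) ^ (-((1 + a) / 2))) *
    ∫⁻ η in Ioi (0 : ℝ), ENNReal.ofReal (η ^ (-a) * f √(y * τ ^ 2 + η ^ 2))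

lemma lintegral_mul_kernel_eq_radialPotential {a x : ℝ} {f : ℝ → ℝ} (ha0 : 0 < a) (ha1 : a < 1)
    (hx : 0 < x) (hf : Measurable f) (hf0 : ∀ ξ, 0 ≤ ξ → 0 ≤ f ξ) :
    (∫⁻ ξ in Ioi (0 : ℝ), ENNReal.ofReal (f ξ * ((ξ / x) * (|x - ξ| ^ (-a) - (x + ξ) ^ (-a))))) *
        ∫⁻ p in Ioi (1 : ℝ), ENNReal.ofReal ((p ^ 2 - 1) ^ (-((1 + a) / 2))) =
      radialPotential a f (x ^ 2) := by
  have hJ := lintegral_Ioi_sq_sub_one_rpow_ne_top ha0 ha1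
  set G : ℝ → ℝ → ENNReal := fun ξ σ => ENNReal.ofReal (f ξ * (ξ / x)) * ENNReal.ofReal
    (2 * ((x ^ 2 - σ ^ 2) * (ξ ^ 2 - σ ^ 2) / σ ^ 2) ^ (-((1 + a) / 2))) with hG
  have hGm : Measurable (Function.uncurry G) := by
    simp only [hG, Function.uncurry_def]
    fun_prop
  have hne : ∀ᵐ ξ ∂(volume.restrict (Ioi (0 : ℝ))), ξ ≠ x :=
    ae_restrict_of_ae (by simp [ae_iff])
  calc _ = ∫⁻ ξ in Ioi (0 : ℝ), ∫⁻ σ in Ioo 0 (min x ξ), G ξ σ := by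
        rw [← lintegral_mul_const' _ _ hJ]
        refine lintegral_congr_ae ?_
        filter_upwards [hne, ae_restrict_mem measurableSet_Ioi] with ξ hξx hξ
        have hξ : 0 < ξ := hξ
        have hk := ENNReal.eq_sub_of_add_eq (ENNReal.mul_ne_top ENNReal.ofReal_ne_top hJ)
          (lintegral_kernel (a := a) hx hξ hξx.symm)
        simp only [hG]
        rw [lintegral_const_mul' _ _ ENNReal.ofReal_ne_top, hk,
          ← ENNReal.sub_mul (fun _ _ => hJ), ← ENNReal.ofReal_sub _ (by positivity),
          ← mul_assoc (f ξ), ENNReal.ofReal_mul (mul_nonneg (hf0 ξ hξ.le) (by positivity)),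
          mul_assoc]
    _ = ∫⁻ σ in Ioo 0 x, ∫⁻ ξ in Ioi σ, G ξ σ := lintegral_Ioi_Ioo_min_swap hGm
    _ = radialPotential a f (x ^ 2) := by
        rw [lintegral_Ioo_zero_eq_mul hx, radialPotential]
        refine setLIntegral_congr_fun measurableSet_Ioo fun τ hτ => ?_
        obtain ⟨hτ0, hτ1⟩ := hτ
        have hτ2 : 0 < (τ ^ 2)⁻¹ - 1 := by
          rw [sub_pos, one_lt_inv₀ (by positivity)]
          nlinarith
        rw [lintegral_Ioi_comp_sqrt (mul_pos hx hτ0),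
          ← lintegral_const_mul' _ _ ENNReal.ofReal_ne_top,
          ← lintegral_const_mul' _ _ ENNReal.ofReal_ne_top]
        refine setLIntegral_congr_fun measurableSet_Ioi fun η hη => ?_
        have hη : 0 < η := hη
        have hr : 0 < √((x * τ) ^ 2 + η ^ 2) := Real.sqrt_pos.2 (by positivity)
        have hr2 : √((x * τ) ^ 2 + η ^ 2) ^ 2 = (x * τ) ^ 2 + η ^ 2 := sq_sqrt (by positivity)
        have hfr := hf0 _ hr.le
        have hw : (x ^ 2 - (x * τ) ^ 2) * ((x * τ) ^ 2 + η ^ 2 - (x * τ) ^ 2) / (x * τ) ^ 2 =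
            ((τ ^ 2)⁻¹ - 1) * η ^ 2 := by
          field_simp
          ring
        have hη2 : η * (η ^ 2) ^ (-((1 + a) / 2)) = η ^ (-a) := by
          rw [← Real.rpow_natCast η 2, ← Real.rpow_mul hη.le]
          nth_rewrite 1 [← Real.rpow_one η]
          rw [← Real.rpow_add hη]
          congr 1
          push_cast
          ring
        have hpos := rpow_nonneg hτ2.le (-((1 + a) / 2))
        simp only [hG]
        rw [hr2, hw, mul_rpow hτ2.le (by positivity), ← mul_pow x τ,
          ← ENNReal.ofReal_mul (by positivity), ← ENNReal.ofReal_mul (by positivity),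
          ← ENNReal.ofReal_mul (by positivity), ← ENNReal.ofReal_mul (by positivity), ← hη2]
        congr 1
        field_simp

lemma radialPotential_zero {a : ℝ} (ha0 : 0 < a) (ha1 : a < 1) (f : ℝ → ℝ) :
    radialPotential a f 0 = ENNReal.ofReal (2 * a) *
      (∫⁻ p in Ioi (1 : ℝ), ENNReal.ofReal ((p ^ 2 - 1) ^ (-((1 + a) / 2)))) *
      ∫⁻ η in Ioi (0 : ℝ), ENNReal.ofReal (η ^ (-a) * f η) := by
  have h : ∀ τ : ℝ, ∫⁻ η in Ioi (0 : ℝ), ENNReal.ofReal (η ^ (-a) * f √(0 * τ ^ 2 + η ^ 2)) =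
      ∫⁻ η in Ioi (0 : ℝ), ENNReal.ofReal (η ^ (-a) * f η) := by
    refine fun τ => setLIntegral_congr_fun measurableSet_Ioi fun η hη => ?_
    have hη : 0 < η := hη
    rw [zero_mul, zero_add, sqrt_sq hη.le]
  simp only [radialPotential, h]
  rw [lintegral_mul_const _ (by fun_prop), ENNReal.ofReal_mul zero_le_two,
    mul_assoc (ENNReal.ofReal 2), ← lintegral_Ioo_inv_sq_sub_one_rpow ha0 ha1,
    ← lintegral_const_mul' _ _ ENNReal.ofReal_ne_top]
  simp only [ENNReal.ofReal_mul zero_le_two]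

lemma radialPotential_le_zero {a : ℝ} {f : ℝ → ℝ} (hf : AntitoneOn f (Ici 0)) {y : ℝ}
    (hy : 0 ≤ y) : radialPotential a f y ≤ radialPotential a f 0 := by
  refine lintegral_mono fun τ => mul_le_mul_right (setLIntegral_mono' measurableSet_Ioi ?_) _
  intro η hη
  have hη : 0 < η := hη
  refine ENNReal.ofReal_le_ofReal (mul_le_mul_of_nonneg_left ?_ (by positivity))
  refine hf (Real.sqrt_nonneg _) (Real.sqrt_nonneg _) (Real.sqrt_le_sqrt ?_)
  nlinarith [mul_nonneg hy (sq_nonneg τ)]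

lemma radialPotential_convex {a : ℝ} {f : ℝ → ℝ} (hfm : Measurable f)
    (hf0 : ∀ ξ, 0 ≤ ξ → 0 ≤ f ξ) (hf : ConvexOn ℝ (Ici 0) fun u => f √u) {y z s t : ℝ} (hy : 0 ≤ y)
    (hz : 0 ≤ z) (hs : 0 ≤ s) (ht : 0 ≤ t) (hst : s + t = 1) :
    radialPotential a f (s * y + t * z) ≤
      ENNReal.ofReal s * radialPotential a f y + ENNReal.ofReal t * radialPotential a f z := by
  unfold radialPotential
  rw [← lintegral_const_mul' _ _ ENNReal.ofReal_ne_top,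
    ← lintegral_const_mul' _ _ ENNReal.ofReal_ne_top, ← lintegral_add_left ?_]
  swap
  · refine Measurable.const_mul (Measurable.mul (by fun_prop) ?_) _
    exact Measurable.lintegral_prod_right' (f := fun z : ℝ × ℝ =>
      ENNReal.ofReal (z.2 ^ (-a) * f √(y * z.1 ^ 2 + z.2 ^ 2))) (by fun_prop)
  refine lintegral_mono fun τ => ?_
  simp only
  rw [mul_left_comm, mul_left_comm (ENNReal.ofReal t), ← mul_add]
  refine mul_le_mul_right ?_ _
  rw [← lintegral_const_mul' _ _ ENNReal.ofReal_ne_top,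
    ← lintegral_const_mul' _ _ ENNReal.ofReal_ne_top, ← lintegral_add_left (by fun_prop)]
  refine setLIntegral_mono' measurableSet_Ioi fun η hη => ?_
  have hη : 0 < η := hη
  have hη0 : 0 ≤ η ^ (-a) := by positivity
  rw [← ENNReal.ofReal_mul hs, ← ENNReal.ofReal_mul ht, ← ENNReal.ofReal_add
    (mul_nonneg hs (mul_nonneg hη0 (hf0 _ (Real.sqrt_nonneg _))))
    (mul_nonneg ht (mul_nonneg hη0 (hf0 _ (Real.sqrt_nonneg _))))]
  refine ENNReal.ofReal_le_ofReal ?_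
  have h := hf.2 (x := y * τ ^ 2 + η ^ 2) (y := z * τ ^ 2 + η ^ 2) (mem_Ici.2 (by positivity))
    (mem_Ici.2 (by positivity)) hs ht hst
  simp only [smul_eq_mul] at h
  have e : s * (y * τ ^ 2 + η ^ 2) + t * (z * τ ^ 2 + η ^ 2) = (s * y + t * z) * τ ^ 2 + η ^ 2 := by
    linear_combination η ^ 2 * hst
  rw [e] at h
  calc _ ≤ η ^ (-a) * (s * f √(y * τ ^ 2 + η ^ 2) + t * f √(z * τ ^ 2 + η ^ 2)) :=
        mul_le_mul_of_nonneg_left h hη0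
    _ = _ := by ring

lemma C3_pos {α : ℝ} (hα : α ∈ Ioo (0 : ℝ) (1 / 2)) : 0 < C3 α := by
  obtain ⟨h0, h1⟩ := hα
  have h4 : (4 : ℝ) < 4 ^ (1 + α) := by
    nth_rewrite 1 [← Real.rpow_one 4]
    exact Real.rpow_lt_rpow_of_exponent_lt (by norm_num) (by linarith)
  have h5 : 4 * α ^ 3 ≤ α := by nlinarith [mul_pos h0 h0, mul_nonneg h0.le (sq_nonneg (2 * α - 1))]
  have h6 := Real.Gamma_pos_of_pos h0
  have h7 := Real.Gamma_pos_of_pos (show 0 < 2 - α by linarith)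
  unfold C3
  refine div_pos (mul_pos (by linarith) h6) ?_
  have h8 : 0 < 5 - 2 * α := by linarith
  have h9 : 0 < 3 - 2 * α := by linarith
  have h10 : 0 < 1 - 2 * α := by linarith
  positivity

lemma lt_deltaU {α t0 : ℝ} (hα : α ∈ Ioo (0 : ℝ) (1 / 2))
    (ht : (1 - 2 * α) / (2 * α * C3 α) < t0 ^ (1 / 2 - α)) : 1 - 2 * α < deltaU α t0 := by
  have hC := C3_pos hα
  obtain ⟨h0, h1⟩ := hα
  rw [div_lt_iff₀ (by positivity)] at ht
  have hT : 0 < C3 α * t0 ^ (1 / 2 - α) := by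
    by_contra! h
    nlinarith
  unfold deltaU
  rw [lt_div_iff₀ (by linarith)]
  linarith

lemma W1.integrableOn {α t0 δl : ℝ} {f : ℝ → ℝ} (hα : α ∈ Ioo (0 : ℝ) (1 / 2))
    (ht : (1 - 2 * α) / (2 * α * C3 α) < t0 ^ (1 / 2 - α)) (hf : W1 α t0 δl f) :
    IntegrableOn (fun ξ => ξ ^ (-(2 * α)) * f ξ) (Ioi 0) := by
  have hδ := lt_deltaU hα ht
  obtain ⟨h0, h1⟩ := hα
  obtain ⟨hcont, -, -, hf1, hf0, hanti, -, -, hfu, -⟩ := hf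
  have hm : Measurable f := hcont.measurable
  rw [← Ioc_union_Ioi_eq_Ioi zero_le_one]
  refine IntegrableOn.union ?_ ?_
  · have hi : IntervalIntegrable (fun p : ℝ => p ^ (-(2 * α))) volume 0 1 :=
      intervalIntegral.intervalIntegrable_rpow' (by linarith)
    rw [intervalIntegrable_iff_integrableOn_Ioc_of_le zero_le_one] at hi
    refine Integrable.mono' hi (by fun_prop) ?_
    filter_upwards [ae_restrict_mem measurableSet_Ioc] with p hp
    have hp0 := hp.1
    have hfp := hf0 p hp0.le
    rw [Real.norm_of_nonneg (by positivity)]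
    refine mul_le_of_le_one_right (by positivity) ?_
    rw [← hf1]
    exact hanti (mem_Ici.2 le_rfl) hp0.le hp0.le
  · have hi : IntegrableOn
        (fun p : ℝ => t0 ^ deltaU α t0 * p ^ (-(2 * α) - deltaU α t0)) (Ioi 1) :=
      (integrableOn_Ioi_rpow_of_lt (by linarith) one_pos).const_mul _
    refine Integrable.mono' hi (by fun_prop) ?_
    filter_upwards [ae_restrict_mem measurableSet_Ioi] with p hp
    have hp0 : 0 < p := one_pos.trans hp
    have hfp := hf0 p hp0.le
    have hle := hfu p
    rw [fu, if_neg hp0.ne', abs_of_pos hp0] at hle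
    rw [Real.norm_of_nonneg (by positivity), sub_eq_add_neg, Real.rpow_add hp0, mul_left_comm]
    exact mul_le_mul_of_nonneg_left (hle.trans (min_le_right _ _)) (by positivity)

lemma Tfr_eq {α x : ℝ} {f : ℝ → ℝ} (hα : α ∈ Ioo (0 : ℝ) (1 / 2)) (hx : 0 ≤ x)
    (hf : Measurable f) (hf0 : ∀ ξ, 0 ≤ ξ → 0 ≤ f ξ) (hanti : AntitoneOn f (Ici 0))
    (hint : IntegrableOn (fun ξ => ξ ^ (-(2 * α)) * f ξ) (Ioi 0)) :
    Tfr α f x = C0 α / α * (4 * α * (∫ ξ in Ioi (0 : ℝ), ξ ^ (-(2 * α)) * f ξ) -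
      (radialPotential (2 * α) f (x ^ 2)).toReal /
        (∫⁻ p in Ioi (1 : ℝ), ENNReal.ofReal ((p ^ 2 - 1) ^ (-((1 + 2 * α) / 2)))).toReal) := by
  obtain ⟨h0, h1⟩ := hα
  have ha0 : 0 < 2 * α := by linarith
  have ha1 : 2 * α < 1 := by linarith
  have hJ := lintegral_Ioi_sq_sub_one_rpow_ne_top ha0 ha1
  have hJ0 := lintegral_Ioi_sq_sub_one_rpow_ne_zero (2 * α)
  have hJpos := ENNReal.toReal_pos hJ0 hJ
  rcases hx.eq_or_lt with rfl | hx
  · have hA : 0 ≤ᵐ[volume.restrict (Ioi 0)] fun ξ : ℝ => ξ ^ (-(2 * α)) * f ξ := by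
      filter_upwards [ae_restrict_mem measurableSet_Ioi] with ξ hξ
      have hξ : 0 < ξ := hξ
      exact mul_nonneg (by positivity) (hf0 ξ hξ.le)
    rw [Tfr, if_pos rfl, zero_pow two_ne_zero, radialPotential_zero ha0 ha1, ENNReal.toReal_mul,
      ENNReal.toReal_mul, ENNReal.toReal_ofReal (by positivity),
      integral_eq_lintegral_of_nonneg_ae hA hint.aestronglyMeasurable]
    rw [mul_right_comm (2 * (2 * α)), mul_div_cancel_right₀ _ hJpos.ne']
    ring
  · have hP : radialPotential (2 * α) f (x ^ 2) ≠ ⊤ := by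
      refine ne_top_of_le_ne_top ?_ (radialPotential_le_zero hanti (sq_nonneg x))
      rw [radialPotential_zero ha0 ha1]
      exact ENNReal.mul_ne_top (ENNReal.mul_ne_top ENNReal.ofReal_ne_top hJ)
        hint.lintegral_lt_top.ne
    have hk := lintegral_mul_kernel_eq_radialPotential ha0 ha1 hx hf hf0
    have hnn : 0 ≤ᵐ[volume.restrict (Ioi 0)] fun ξ : ℝ =>
        f ξ * ((ξ / x) * (|x - ξ| ^ (-(2 * α)) - (x + ξ) ^ (-(2 * α)))) := by
      have hne : ∀ᵐ ξ ∂(volume.restrict (Ioi (0 : ℝ))), ξ ≠ x :=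
        ae_restrict_of_ae (by simp [ae_iff])
      filter_upwards [hne, ae_restrict_mem measurableSet_Ioi] with ξ hξx hξ
      have hξ : 0 < ξ := hξ
      refine mul_nonneg (hf0 ξ hξ.le) (mul_nonneg (by positivity) (sub_nonneg.2 ?_))
      refine rpow_le_rpow_of_nonpos (abs_pos.2 (sub_ne_zero.2 hξx.symm)) ?_ (by linarith)
      rw [abs_le]
      constructor <;> linarith
    have hmeas : Measurable fun ξ : ℝ =>
        f ξ * ((ξ / x) * (|x - ξ| ^ (-(2 * α)) - (x + ξ) ^ (-(2 * α)))) := by fun_prop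
    have hL : ∫⁻ ξ in Ioi (0 : ℝ), ENNReal.ofReal
        (f ξ * ((ξ / x) * (|x - ξ| ^ (-(2 * α)) - (x + ξ) ^ (-(2 * α))))) ≠ ⊤ := by
      intro h
      rw [h, ENNReal.top_mul hJ0] at hk
      exact hP hk.symm
    have hi : IntegrableOn (fun ξ : ℝ =>
        f ξ * ((ξ / x) * (|x - ξ| ^ (-(2 * α)) - (x + ξ) ^ (-(2 * α))))) (Ioi 0) :=
      (lintegral_ofReal_ne_top_iff_integrable hmeas.aestronglyMeasurable hnn).1 hL
    rw [Tfr, if_neg hx.ne', abs_of_pos hx, ← hk, ENNReal.toReal_mul,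
      mul_div_cancel_right₀ _ hJpos.ne',
      ← integral_eq_lintegral_of_nonneg_ae hnn hmeas.aestronglyMeasurable,
      ← integral_const_mul (4 * α),
      ← integral_sub (hint.const_mul _) hi]
    congr 2
    ext ξ
    ring

/-- For every `α ∈ (0,1/2)` and every `f ∈ 𝒲₁`, `x ↦ 𝔗_α(f)(√x)` is concave on `[0,∞)`. -/
theorem Tfr_sqrt_concave (α t0 δl : ℝ) (hα : α ∈ Ioo (0:ℝ) (1/2)) (ht0 : 1 < t0)
    (ht1 : max (1 / C3 α) ((1 - 2*α) / (2*α * C3 α)) < t0 ^ (1/2 - α))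
    (ht2 : (2:ℝ) ^ ((2:ℝ) ^ α + 2) * Real.Gamma (2 + α) * Real.Gamma (1/2 - α) /
        (3*π*α*Real.Gamma (1 - α)) < t0 ^ (1/2 + α))
    (hδl : 1/2 ≤ δl)
    (hδ1 : (2:ℝ) ^ (2*α) * Real.Gamma (2 + α) * Real.Gamma (1/2 - α) /
        (3*π*Real.Gamma (1 - α)) ≤
        Real.Gamma (δl + 1) * t0 ^ (2*α - 1) / Real.Gamma (δl + α + 1/2))
    (hδ2 : Real.Gamma (δl + 1) * t0 ^ (2*α - 1) / Real.Gamma (δl + α + 1/2) ≤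
        (2:ℝ) ^ (2*α + 1) * Real.Gamma (2 + α) * Real.Gamma (1/2 - α) /
        (3*π*Real.Gamma (1 - α)))
    (f : ℝ → ℝ) (hf : W1 α t0 δl f) :
    ConcaveOn ℝ (Ici (0:ℝ)) (fun x => Tfr α f (Real.sqrt x)) := by

  have ha0 : 0 < 2 * α := by linarith [hα.1]
  have ha1 : 2 * α < 1 := by linarith [hα.2]
  have hint := hf.integrableOn hα ((le_max_right _ _).trans_lt ht1)
  obtain ⟨hcont, -, -, -, hf0, hanti, hconv, -⟩ := hf
  have hJ := lintegral_Ioi_sq_sub_one_rpow_ne_top ha0 ha1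
  have hP : ∀ y, 0 ≤ y → radialPotential (2 * α) f y ≠ ⊤ := by
    intro y hy
    refine ne_top_of_le_ne_top ?_ (radialPotential_le_zero hanti hy)
    rw [radialPotential_zero ha0 ha1]
    exact ENNReal.mul_ne_top (ENNReal.mul_ne_top ENNReal.ofReal_ne_top hJ) hint.lintegral_lt_top.ne
  have hPconv : ConvexOn ℝ (Ici 0) fun y => (radialPotential (2 * α) f y).toReal := by
    refine ⟨convex_Ici 0, fun y hy z hz s t hs ht hst => ?_⟩
    have hsy := ENNReal.mul_ne_top (ENNReal.ofReal_ne_top (r := s)) (hP y hy)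
    have htz := ENNReal.mul_ne_top (ENNReal.ofReal_ne_top (r := t)) (hP z hz)
    have h := ENNReal.toReal_mono (ENNReal.add_ne_top.2 ⟨hsy, htz⟩)
      (radialPotential_convex (a := 2 * α) hcont.measurable hf0 hconv hy hz hs ht hst)
    rwa [ENNReal.toReal_add hsy htz, ENNReal.toReal_mul, ENNReal.toReal_mul,
      ENNReal.toReal_ofReal hs, ENNReal.toReal_ofReal ht] at h
  have hC : 0 ≤ C0 α / α := by
    have h1 := Real.Gamma_pos_of_pos (show 0 < 1 + α by linarith)
    have h2 := Real.Gamma_pos_of_pos (show 0 < 1 - α by linarith)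
    have h3 := hα.1
    unfold C0
    positivity
  have hD := (((concaveOn_const (4 * α * ∫ ξ in Ioi (0 : ℝ), ξ ^ (-(2 * α)) * f ξ)
    (convex_Ici 0)).sub (hPconv.smul (inv_nonneg.2 (ENNReal.toReal_nonneg (a := ∫⁻ p in Ioi (1 : ℝ),
      ENNReal.ofReal ((p ^ 2 - 1) ^ (-((1 + 2 * α) / 2)))))))).smul hC)
  refine hD.congr fun y hy => ?_
  have hy : 0 ≤ y := hy
  rw [Tfr_eq hα (Real.sqrt_nonneg y) hcont.measurable hf0 hanti hint, sq_sqrt hy]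
  simp only [Pi.sub_apply, smul_eq_mul]
  rw [div_eq_inv_mul (ENNReal.toReal _)]

end GSQGhalfplane
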